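/- arXiv:2106.06806 — 5 statements merged into one kernel-verified Lean document; each statement's English description precedes it below -/
import Mathlib

section
/- Let d ≥ 1 and κ > 0. Suppose u : [0,∞) × ℝ^d → ℝ is continuous, is smooth on (0,∞) × ℝ^d, is 2π-periodic in each spatial coordinate, and solves the parabolic sine-Gordon equation ∂_t u = κ²Δu + sin u on (0,∞) × ℝ^d. If the initial data satisfies |u(0,x)| ≤ π for all x ∈ ℝ^d, then |u(t,x)| ≤ π for all t ≥ 0 and all x ∈ ℝ^d. -/
open MeasureTheory Real

/-- The Laplacian of `f : ℝ^d → ℝ` at `x`, as the sum of second partial derivatives. -/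
noncomputable def lap {d : ℕ} (f : (Fin d → ℝ) → ℝ) (x : Fin d → ℝ) : ℝ :=
  ∑ i, fderiv ℝ (fun y => fderiv ℝ f y (Pi.single i 1)) x (Pi.single i 1)

/-- Second derivative test: at a local maximum, the second derivative is nonpositive. -/
theorem IsLocalMax.deriv_deriv_nonpos {g : ℝ → ℝ} {a : ℝ} (h : IsLocalMax g a)
    (hc : ContinuousAt g a) : deriv (deriv g) a ≤ 0 := by
  by_contra! hpos
  have hmin : IsLocalMin g a := isLocalMin_of_deriv_deriv_pos hpos h.deriv_eq_zero hc
  have hconst : g =ᶠ[nhds a] fun _ => g a := by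
    filter_upwards [h, hmin] with s h₁ h₂ using le_antisymm h₁ h₂
  have : deriv (deriv g) a = 0 := by
    rw [hconst.deriv.deriv_eq]
    simp
  exact hpos.ne' this

/-- At a maximum over an interval to the left, the derivative is nonnegative. -/
theorem HasDerivAt.nonneg_of_forall_le_left {g : ℝ → ℝ} {g' a b : ℝ} (hg : HasDerivAt g g' b)
    (hab : a < b) (hmax : ∀ s ∈ Set.Icc a b, g s ≤ g b) : 0 ≤ g' := by
  have hlim := hasDerivWithinAt_iff_tendsto_slope.1 (hg.hasDerivWithinAt (s := Set.Iio b))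
  rw [Set.sdiff_singleton_eq_self (by simp)] at hlim
  refine ge_of_tendsto hlim ?_
  filter_upwards [Ioo_mem_nhdsLT hab] with s hs
  rw [slope_def_field]
  exact div_nonneg_of_nonpos (by linarith [hmax s ⟨hs.1.le, hs.2.le⟩]) (by linarith [hs.2])

theorem lap_neg {d : ℕ} (f : (Fin d → ℝ) → ℝ) (x : Fin d → ℝ) :
    lap (fun y => -f y) x = -lap f x := by
  simp [lap, fderiv_fun_neg]

/-- The Laplacian of a `C²` function is nonpositive at a global maximum. -/
theorem lap_nonpos_of_forall_le {d : ℕ} {f : (Fin d → ℝ) → ℝ} (hf : ContDiff ℝ 2 f)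
    {x : Fin d → ℝ} (hmax : ∀ y, f y ≤ f x) : lap f x ≤ 0 := by
  refine Finset.sum_nonpos fun i _ => ?_
  set e : Fin d → ℝ := Pi.single i 1
  have hline (s : ℝ) : HasDerivAt (fun s : ℝ => x + s • e) e s := by
    simpa using ((hasDerivAt_id s).smul_const e).const_add x
  have hderiv : deriv (fun s : ℝ => f (x + s • e)) = fun s => fderiv ℝ f (x + s • e) e := by
    ext s
    exact ((hf.differentiable (by norm_num) _).hasFDerivAt.comp_hasDerivAt s (hline s)).deriv
  have hf' : Differentiable ℝ fun y => fderiv ℝ f y e :=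
    ((hf.fderiv_right (m := 1) (by norm_num)).clm_apply contDiff_const).differentiable
      (by norm_num)
  have hderiv₂ : deriv (deriv fun s : ℝ => f (x + s • e)) 0 =
      fderiv ℝ (fun y => fderiv ℝ f y e) x e := by
    rw [hderiv]
    simpa [Function.comp_def] using
      ((hf' _).hasFDerivAt.comp_hasDerivAt (0 : ℝ) (hline 0)).deriv
  rw [← hderiv₂]
  refine IsLocalMax.deriv_deriv_nonpos (Filter.Eventually.of_forall fun s => ?_) ?_
  · simpa using hmax _
  · have := hf.continuous
    fun_prop

/-- A function periodic in each coordinate attains all its values on the fundamental cube. -/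
theorem exists_mem_Icc_forall_eq_of_periodic {d : ℕ} {α β : Type*} {p : ℝ} (hp : 0 < p)
    (u : α → (Fin d → ℝ) → β) (hper : ∀ t x i, u t (x + Pi.single i p) = u t x)
    (x : Fin d → ℝ) :
    ∃ y ∈ Set.Icc (0 : Fin d → ℝ) (fun _ => p), ∀ t, u t y = u t x := by
  refine ⟨fun i => toIcoMod hp 0 (x i), ⟨fun i => ?_, fun i => ?_⟩, fun t => ?_⟩
  · exact (toIcoMod_mem_Ico hp 0 (x i)).1
  · simpa using (toIcoMod_mem_Ico hp 0 (x i)).2.le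
  · have hsum (s : Finset (Fin d)) :
        Function.Periodic (u t) (∑ i ∈ s, toIcoDiv hp 0 (x i) • Pi.single i p) := by
      induction s using Finset.induction_on with
      | empty => simp [Function.Periodic]
      | insert i s hi ih =>
        rw [Finset.sum_insert hi]
        exact Function.Periodic.add_period
          (Function.Periodic.zsmul (fun x => hper t x i) _) ih
    rw [← hsum Finset.univ]
    congr 1
    ext j
    simp [Finset.sum_apply, Pi.single_apply]

/-- One-sided maximum principle: the bound `u ≤ π` is preserved by the flow. -/
theorem parabolic_sine_gordon_le_pi {d : ℕ} (κ : ℝ)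
    (u : ℝ → (Fin d → ℝ) → ℝ)
    (hcont : ContinuousOn (fun p : ℝ × (Fin d → ℝ) => u p.1 p.2)
      {p : ℝ × (Fin d → ℝ) | 0 ≤ p.1})
    (hsmooth : ContDiffOn ℝ 2 (fun p : ℝ × (Fin d → ℝ) => u p.1 p.2)
      {p : ℝ × (Fin d → ℝ) | 0 < p.1})
    (hper : ∀ t : ℝ, ∀ x : Fin d → ℝ, ∀ i : Fin d,
      u t (x + Pi.single i (2 * π)) = u t x)
    (heq : ∀ t : ℝ, 0 < t → ∀ x : Fin d → ℝ,
      deriv (fun s => u s x) t = κ ^ 2 * lap (u t) x + Real.sin (u t x))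
    (hinit : ∀ x : Fin d → ℝ, u 0 x ≤ π) {T : ℝ} (hT : 0 ≤ T) (z : Fin d → ℝ) :
    u T z ≤ π := by
  by_contra! hz
  let v : ℝ × (Fin d → ℝ) → ℝ := fun p => exp (-2 * p.1) * (u p.1 p.2 - π)
  let K : Set (ℝ × (Fin d → ℝ)) := Set.Icc 0 T ×ˢ Set.Icc 0 (fun _ => 2 * π)
  have hbox := exists_mem_Icc_forall_eq_of_periodic two_pi_pos u hper
  have hvcont : ContinuousOn v K := by
    have : ContinuousOn (fun p : ℝ × (Fin d → ℝ) => u p.1 p.2) K :=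
      hcont.mono fun p hp => hp.1.1
    exact (by fun_prop : Continuous fun p : ℝ × (Fin d → ℝ) => exp (-2 * p.1)).continuousOn.mul
      (this.sub continuousOn_const)
  obtain ⟨z', hz', hzz'⟩ := hbox z
  obtain ⟨⟨t, x⟩, ⟨ht, hx⟩, hmaxK⟩ :=
    (isCompact_Icc.prod isCompact_Icc : IsCompact K).exists_isMaxOn
      ⟨(T, z'), ⟨hT, le_rfl⟩, hz'⟩ hvcont
  have hmax (s : ℝ) (hs : s ∈ Set.Icc 0 T) (y : Fin d → ℝ) : v (s, y) ≤ v (t, x) := by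
    obtain ⟨y', hy', hyy'⟩ := hbox y
    have : v (s, y') ≤ v (t, x) := hmaxK (⟨hs, hy'⟩ : (s, y') ∈ K)
    simpa only [v, hyy'] using this
  have hpos : 0 < v (t, x) :=
    lt_of_lt_of_le (mul_pos (exp_pos _) (sub_pos.2 hz)) (hmax T ⟨hT, le_rfl⟩ z)
  have hux : 0 < u t x - π := pos_of_mul_pos_right hpos (exp_pos _).le
  have ht0 : 0 < t := by
    refine ht.1.lt_of_ne ?_
    rintro rfl
    linarith [hinit x]
  have hat (y : Fin d → ℝ) : ContDiffAt ℝ 2 (fun p : ℝ × (Fin d → ℝ) => u p.1 p.2) (t, y) :=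
    hsmooth.contDiffAt ((isOpen_lt continuous_const continuous_fst).mem_nhds ht0)
  have hspace : ContDiff ℝ 2 (u t) := contDiff_iff_contDiffAt.2 fun y =>
    (hat y).comp y (f := fun y => (t, y)) (contDiffAt_const.prodMk contDiffAt_id)
  have htime : DifferentiableAt ℝ (fun s => u s x) t :=
    ((hat x).comp t (f := fun s => (s, x))
      (contDiffAt_id.prodMk contDiffAt_const)).differentiableAt (by norm_num)
  have hlap : lap (u t) x ≤ 0 := by
    refine lap_nonpos_of_forall_le hspace fun y => ?_
    have := le_of_mul_le_mul_left (hmax t ht y) (exp_pos _)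
    linarith
  have hexp : HasDerivAt (fun s : ℝ => exp (-2 * s)) (exp (-2 * t) * -2) t := by
    simpa using ((hasDerivAt_id t).const_mul (-2)).exp
  have hv := (hexp.mul (htime.hasDerivAt.sub_const π)).nonneg_of_forall_le_left ht0
    fun s hs => hmax s ⟨hs.1, hs.2.trans ht.2⟩ x
  have hsin : sin (u t x) ≤ u t x - π := by
    have habs := neg_le_of_abs_le (abs_sin_le_abs (x := u t x - π))
    rw [abs_of_pos hux] at habs
    rw [sin_sub_pi] at habs
    linarith
  rw [heq t ht0 x] at hv
  have hdiff : κ ^ 2 * lap (u t) x ≤ 0 := mul_nonpos_of_nonneg_of_nonpos (sq_nonneg κ) hlap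
  have hneg : exp (-2 * t) *
      (-2 * (u t x - π) + (κ ^ 2 * lap (u t) x + sin (u t x))) < 0 :=
    mul_neg_of_pos_of_neg (exp_pos _) (by linarith)
  linarith

/-- **Maximum principle for the parabolic sine-Gordon equation.**
If `u` is continuous on `[0,∞) × ℝ^d`, smooth on `(0,∞) × ℝ^d`, `2π`-periodic in each
spatial coordinate, solves `∂ₜ u = κ² Δu + sin u` on `(0,∞) × ℝ^d`, and `|u(0,·)| ≤ π`,
then `|u(t,·)| ≤ π` for all `t ≥ 0`. -/
theorem parabolic_sine_gordon_maximum_principle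
    (d : ℕ) (hd : 1 ≤ d) (κ : ℝ) (hκ : 0 < κ)
    (u : ℝ → (Fin d → ℝ) → ℝ)
    (hcont : ContinuousOn (fun p : ℝ × (Fin d → ℝ) => u p.1 p.2)
      {p : ℝ × (Fin d → ℝ) | 0 ≤ p.1})
    (hsmooth : ContDiffOn ℝ (⊤ : ℕ∞) (fun p : ℝ × (Fin d → ℝ) => u p.1 p.2)
      {p : ℝ × (Fin d → ℝ) | 0 < p.1})
    (hper : ∀ t : ℝ, ∀ x : Fin d → ℝ, ∀ i : Fin d,
      u t (x + Pi.single i (2 * π)) = u t x)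
    (heq : ∀ t : ℝ, 0 < t → ∀ x : Fin d → ℝ,
      deriv (fun s => u s x) t = κ ^ 2 * lap (u t) x + Real.sin (u t x))
    (hinit : ∀ x : Fin d → ℝ, |u 0 x| ≤ π) :
    ∀ t : ℝ, 0 ≤ t → ∀ x : Fin d → ℝ, |u t x| ≤ π := by
  have hsmooth₂ := hsmooth.of_le (m := 2) (WithTop.coe_le_coe.2 le_top)
  intro t ht x
  refine abs_le.2 ⟨?_, parabolic_sine_gordon_le_pi κ u hcont hsmooth₂ hper heq
    (fun x => (abs_le.1 (hinit x)).2) ht x⟩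
  refine neg_le.1 (parabolic_sine_gordon_le_pi κ (fun t x => -u t x) hcont.neg hsmooth₂.neg
    (fun t x i => by simp only [hper]) (fun t ht x => ?_)
    (fun x => neg_le.1 (abs_le.1 (hinit x)).1) ht x)
  rw [deriv.fun_neg, heq t ht x, lap_neg, sin_neg]
  ring
end

section
/- (Odd reflection rigidity.) Let κ > 0 and r₀ > 0. Suppose u is twice continuously differentiable on the open interval (0, r₀), satisfies κ²u'' + sin u = 0 on (0, r₀), and lim_{x→0⁺} u(x) = 0. Extend u to (-r₀, r₀) by setting u(0) = 0 and u(x) = -u(-x) for -r₀ < x < 0. Then the extended function u is infinitely differentiable on (-r₀, r₀), satisfies u(0) = 0, and solves κ²u'' + sin u = 0 on all of (-r₀, r₀). -/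
open Real Filter Set

open scoped Topology

/-- The odd extension of the restriction of `u` to the positive half-line. -/
noncomputable def oddExtension (u : ℝ → ℝ) (x : ℝ) : ℝ := (SignType.sign x : ℝ) * u |x|

lemma oddExtension_of_pos (u : ℝ → ℝ) {x : ℝ} (hx : 0 < x) : oddExtension u x = u x := by
  simp [oddExtension, sign_pos hx, abs_of_pos hx]

lemma oddExtension_of_neg (u : ℝ → ℝ) {x : ℝ} (hx : x < 0) : oddExtension u x = -u (-x) := by
  simp [oddExtension, sign_neg hx, abs_of_neg hx]

@[simp]
lemma oddExtension_zero (u : ℝ → ℝ) : oddExtension u 0 = 0 := by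
  simp [oddExtension]

lemma sin_oddExtension (u : ℝ → ℝ) (x : ℝ) :
    Real.sin (oddExtension u x) = SignType.sign x * Real.sin (u |x|) := by
  rcases lt_trichotomy x 0 with hx | rfl | hx
  · simp [oddExtension, sign_neg hx]
  · simp
  · simp [oddExtension, sign_pos hx]

lemma HasDerivAt.oddExtension {u : ℝ → ℝ} {u' x : ℝ} (hu : HasDerivAt u u' |x|) (hx : x ≠ 0) :
    HasDerivAt (oddExtension u) u' x := by
  rcases hx.lt_or_gt with hx | hx
  · rw [abs_of_neg hx] at hu
    have h := (hu.scomp x (hasDerivAt_neg x)).neg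
    refine (h.congr_deriv (by simp)).congr_of_eventuallyEq ?_
    filter_upwards [Iio_mem_nhds hx] with y hy
    simp [oddExtension_of_neg u hy]
  · rw [abs_of_pos hx] at hu
    refine hu.congr_of_eventuallyEq ?_
    filter_upwards [Ioi_mem_nhds hx] with y hy
    exact oddExtension_of_pos u hy

lemma continuousAt_oddExtension_zero {u : ℝ → ℝ} (hu : Tendsto u (𝓝[>] 0) (𝓝 0)) :
    ContinuousAt (oddExtension u) 0 := by
  rw [continuousAt_iff_punctured_nhds, oddExtension_zero]
  refine squeeze_zero_norm' ?_ (by simpa using (hu.comp tendsto_abs_nhdsNE_zero).abs)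
  filter_upwards [self_mem_nhdsWithin] with x hx
  rcases (show x ≠ 0 from hx).lt_or_gt with hx | hx
  · simp [oddExtension, sign_neg hx]
  · simp [oddExtension, sign_pos hx]

/-- If `f` has derivative `g` on a punctured neighborhood of `x`, and both functions are
continuous at `x`, then `f` has derivative `g x` at `x`. -/
lemma hasDerivAt_of_eventually_nhdsNE {f g : ℝ → ℝ} {x : ℝ}
    (h : ∀ᶠ y in 𝓝[≠] x, HasDerivAt f (g y) y) (hf : ContinuousAt f x)
    (hg : ContinuousAt g x) : HasDerivAt f (g x) x := by
  have diff : DifferentiableOn ℝ f {y | HasDerivAt f (g y) y} := fun y hy =>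
    (HasDerivAt.differentiableAt hy).differentiableWithinAt
  have lim {l : Filter ℝ} (hl : l ≤ 𝓝[≠] x) : Tendsto (deriv f) l (𝓝 (g x)) :=
    Tendsto.congr' ((h.filter_mono hl).mono fun _ hy => hy.deriv.symm)
      (hg.tendsto.mono_left (hl.trans nhdsWithin_le_nhds))
  have hgt : 𝓝[>] x ≤ 𝓝[≠] x := nhdsGT_le_nhdsNE x
  have hlt : 𝓝[<] x ≤ 𝓝[≠] x := nhdsLT_le_nhdsNE x
  have right := hasDerivWithinAt_Ici_of_tendsto_deriv diff hf.continuousWithinAt (hgt h) (lim hgt)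
  have left := hasDerivWithinAt_Iic_of_tendsto_deriv diff hf.continuousWithinAt (hlt h) (lim hlt)
  simpa using right.union left

/-- Solutions of the autonomous second-order equation `v'' = F v` with `F` smooth are smooth. -/
lemma contDiffOn_infty_of_hasDerivAt_of_hasDerivAt_comp {v p F : ℝ → ℝ} {s : Set ℝ}
    (hs : IsOpen s) (hF : ContDiff ℝ (⊤ : ℕ∞) F) (hv : ∀ x ∈ s, HasDerivAt v (p x) x)
    (hp : ∀ x ∈ s, HasDerivAt p (F (v x)) x) : ContDiffOn ℝ (⊤ : ℕ∞) v s := by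
  have step {f f' : ℝ → ℝ} {n : ℕ} (hf : ∀ x ∈ s, HasDerivAt f (f' x) x)
      (hf' : ContDiffOn ℝ n f' s) : ContDiffOn ℝ (n + 1 : ℕ) f s := by
    push_cast
    refine (contDiffOn_succ_iff_deriv_of_isOpen hs).2
      ⟨fun x hx => (hf x hx).differentiableAt.differentiableWithinAt, by simp, ?_⟩
    exact hf'.congr fun x hx => (hf x hx).deriv
  have key (n : ℕ) : ContDiffOn ℝ n v s ∧ ContDiffOn ℝ n p s := by
    induction n with
    | zero =>
      simp only [Nat.cast_zero, contDiffOn_zero]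
      exact ⟨fun x hx => (hv x hx).continuousAt.continuousWithinAt,
        fun x hx => (hp x hx).continuousAt.continuousWithinAt⟩
    | succ n ih =>
      have hFn : ContDiff ℝ n F := hF.of_le (by exact_mod_cast le_top)
      exact ⟨step hv ih.2, step hp (hFn.comp_contDiffOn ih.1)⟩
  exact contDiffOn_infty.2 fun n => (key n).1

/-- A differentiable function with bounded derivative on an open interval agrees there with a
continuous function on the whole line. -/
lemma exists_continuous_eqOn_Ioo_of_abs_deriv_le {f f' : ℝ → ℝ} {a b C : ℝ}
    (hf : ∀ x ∈ Ioo a b, HasDerivAt f (f' x) x) (hC : ∀ x ∈ Ioo a b, |f' x| ≤ C) :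
    ∃ g : ℝ → ℝ, Continuous g ∧ EqOn f g (Ioo a b) := by
  have hlip : LipschitzOnWith C.toNNReal f (Ioo a b) :=
    (convex_Ioo a b).lipschitzOnWith_of_nnnorm_hasDerivWithin_le
      (fun x hx => (hf x hx).hasDerivWithinAt)
      fun x hx => by
        rw [← NNReal.coe_le_coe, coe_nnnorm]
        exact (hC x hx).trans (le_coe_toNNReal C)
  obtain ⟨g, hg, hfg⟩ := hlip.extend_real
  exact ⟨g, hg.continuous, hfg⟩

/-- **Odd reflection rigidity for the steady sine-Gordon equation.**
If `u` is `C²` on `(0, r₀)`, solves `κ²u'' + sin u = 0` there, and `u(x) → 0` as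
`x → 0⁺`, then the odd extension (with `v(0) = 0` and `v(x) = -u(-x)` for
`-r₀ < x < 0`) is `C^∞` on `(-r₀, r₀)`, vanishes at `0`, and solves the same equation
on all of `(-r₀, r₀)`. -/
theorem sine_gordon_odd_reflection
    (κ r₀ : ℝ) (hκ : 0 < κ) (hr₀ : 0 < r₀)
    (u : ℝ → ℝ)
    (hreg : ContDiffOn ℝ 2 u (Ioo (0 : ℝ) r₀))
    (heq : ∀ x ∈ Ioo (0 : ℝ) r₀, κ ^ 2 * deriv (deriv u) x + Real.sin (u x) = 0)
    (hlim : Tendsto u (nhdsWithin 0 (Ioi 0)) (nhds 0)) :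
    ∃ v : ℝ → ℝ,
      (∀ x ∈ Ioo (0 : ℝ) r₀, v x = u x) ∧
      (∀ x ∈ Ioo (-r₀) (0 : ℝ), v x = -u (-x)) ∧
      v 0 = 0 ∧
      ContDiffOn ℝ (⊤ : ℕ∞) v (Ioo (-r₀) r₀) ∧
      ∀ x ∈ Ioo (-r₀) r₀, κ ^ 2 * deriv (deriv v) x + Real.sin (v x) = 0 := by
  have hu' : ∀ x ∈ Ioo 0 r₀, HasDerivAt u (deriv u x) x := fun x hx =>
    ((hreg.differentiableOn (by norm_num)).differentiableAt (isOpen_Ioo.mem_nhds hx)).hasDerivAt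
  have hu'' : ∀ x ∈ Ioo 0 r₀, HasDerivAt (deriv u) (-Real.sin (u x) / κ ^ 2) x := by
    intro x hx
    have h1 : ContDiffOn ℝ 1 (deriv u) (Ioo 0 r₀) :=
      hreg.deriv_of_isOpen isOpen_Ioo (by norm_num)
    have h2 := ((h1.differentiableOn (by norm_num)).differentiableAt
      (isOpen_Ioo.mem_nhds hx)).hasDerivAt
    refine h2.congr_deriv ?_
    rw [eq_div_iff (by positivity)]
    linarith [heq x hx]
  obtain ⟨g, hg, hug⟩ := exists_continuous_eqOn_Ioo_of_abs_deriv_le hu'' (C := 1 / κ ^ 2) <| by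
    intro x _
    rw [abs_div, abs_neg, abs_of_pos (pow_pos hκ 2)]
    gcongr
    exact abs_sin_le_one _
  set v := oddExtension u
  let p : ℝ → ℝ := fun x => g |x|
  let F : ℝ → ℝ := fun y => -Real.sin y / κ ^ 2
  have hF : ContDiff ℝ (⊤ : ℕ∞) F := contDiff_sin.neg.div_const _
  have habs : ∀ x ∈ Ioo (-r₀) r₀, x ≠ 0 → |x| ∈ Ioo 0 r₀ := fun x hx h0 =>
    ⟨abs_pos.2 h0, abs_lt.2 hx⟩
  have hv_ne : ∀ x ∈ Ioo (-r₀) r₀, x ≠ 0 → HasDerivAt v (p x) x := fun x hx h0 =>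
    ((hu' _ (habs x hx h0)).oddExtension h0).congr_deriv (hug (habs x hx h0))
  have hp_ne : ∀ x ∈ Ioo (-r₀) r₀, x ≠ 0 → HasDerivAt p (F (v x)) x := by
    intro x hx h0
    have hg' : HasDerivAt g (-Real.sin (u |x|) / κ ^ 2) |x| :=
      (hu'' _ (habs x hx h0)).congr_of_eventuallyEq
        (hug.symm.eventuallyEq_of_mem (isOpen_Ioo.mem_nhds (habs x hx h0)))
    refine (hg'.comp x (hasDerivAt_abs h0)).congr_deriv ?_
    simp only [F, v, sin_oddExtension]
    ring
  have h0_nhds : ∀ᶠ x in 𝓝[≠] (0 : ℝ), x ∈ Ioo (-r₀) r₀ ∧ x ≠ 0 :=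
    (eventually_nhdsWithin_of_eventually_nhds (Ioo_mem_nhds (neg_lt_zero.2 hr₀) hr₀)).and
      self_mem_nhdsWithin
  have hv_cont : ContinuousAt v 0 := continuousAt_oddExtension_zero hlim
  have hp_cont : Continuous p := hg.comp continuous_abs
  have hv : ∀ x ∈ Ioo (-r₀) r₀, HasDerivAt v (p x) x := by
    intro x hx
    rcases eq_or_ne x 0 with rfl | h0
    · exact hasDerivAt_of_eventually_nhdsNE (h0_nhds.mono fun y hy => hv_ne y hy.1 hy.2)
        hv_cont hp_cont.continuousAt
    · exact hv_ne x hx h0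
  have hp : ∀ x ∈ Ioo (-r₀) r₀, HasDerivAt p (F (v x)) x := by
    intro x hx
    rcases eq_or_ne x 0 with rfl | h0
    · exact hasDerivAt_of_eventually_nhdsNE (g := F ∘ v)
        (h0_nhds.mono fun y hy => hp_ne y hy.1 hy.2) hp_cont.continuousAt
        (hF.continuous.continuousAt.comp hv_cont)
    · exact hp_ne x hx h0
  refine ⟨v, fun x hx => oddExtension_of_pos u hx.1, fun x hx => oddExtension_of_neg u hx.2,
    oddExtension_zero u, contDiffOn_infty_of_hasDerivAt_of_hasDerivAt_comp isOpen_Ioo hF hv hp,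
    fun x hx => ?_⟩
  have hderiv : deriv v =ᶠ[𝓝 x] p := by
    filter_upwards [isOpen_Ioo.mem_nhds hx] with y hy
    exact (hv y hy).deriv
  rw [hderiv.deriv_eq, (hp x hx).deriv]
  simp only [F]
  field_simp
  ring
end

section
/- Let κ > 0. Suppose u : ℝ → ℝ is a bounded, twice differentiable function satisfying κ²u''(x) + sin u(x) = 0 for all x ∈ ℝ, |u(0)| ≤ π, and the first integral identity (κ²/2)(u'(x))² = 1 + cos u(x) for all x ∈ ℝ (i.e., the first-integral constant is C = 1). Then either u ≡ π, or u ≡ -π, or there exists a constant c ∈ ℝ such that u(x) = 2 arcsin(tanh(x/κ + c)) for all x, or there exists a constant c ∈ ℝ such that u(x) = -2 arcsin(tanh(x/κ + c)) for all x. -/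
open Real
open scoped NNReal

theorem eq_zero_of_hasDerivAt_mul {a f : ℝ → ℝ} {K : ℝ≥0} {t₀ : ℝ} (ha : ∀ t, ‖a t‖₊ ≤ K)
    (hf : ∀ t, HasDerivAt f (a t * f t) t) (h₀ : f t₀ = 0) : f = fun _ ↦ 0 :=
  ODE_solution_unique_univ (v := fun t y ↦ a t * y) (s := fun _ ↦ Set.univ) (K := K) (t₀ := t₀)
    (fun t ↦ ((lipschitzWith_smul (a t)).weaken (ha t)).lipschitzOnWith)
    (fun t ↦ ⟨hf t, trivial⟩) (fun t ↦ ⟨by simpa using hasDerivAt_const t (0 : ℝ), trivial⟩) h₀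

theorem hasDerivAt_tanh (x : ℝ) : HasDerivAt tanh (1 / cosh x ^ 2) x := by
  have h := (hasDerivAt_sinh x).fun_div (hasDerivAt_cosh x) (cosh_pos x).ne'
  rw [show cosh x * cosh x - sinh x * sinh x = 1 by linarith [cosh_sq_sub_sinh_sq x]] at h
  exact h.congr_of_eventuallyEq (.of_forall tanh_eq_sinh_div_cosh)

theorem sqrt_one_sub_tanh_sq (x : ℝ) : √(1 - tanh x ^ 2) = 1 / cosh x := by
  rw [← sqrt_sq (one_div_pos.2 (cosh_pos x)).le, tanh_eq_sinh_div_cosh]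
  congr 1
  have := (cosh_pos x).ne'
  field_simp
  linarith [cosh_sq x]

theorem hasDerivAt_arcsin_tanh (x : ℝ) :
    HasDerivAt (fun y ↦ arcsin (tanh y)) (cos (arcsin (tanh x))) x := by
  have h := (hasDerivAt_arcsin (neg_one_lt_tanh x).ne' (tanh_lt_one x).ne).comp x
    (hasDerivAt_tanh x)
  refine h.congr_deriv ?_
  rw [cos_arcsin, sqrt_one_sub_tanh_sq]
  have := (cosh_pos x).ne'
  field_simp

theorem eq_of_hasDerivAt_mul_cos_half {k : ℝ} {u v : ℝ → ℝ}
    (hu : ∀ x, HasDerivAt u (k * cos (u x / 2)) x) (hv : ∀ x, HasDerivAt v (k * cos (v x / 2)) x)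
    (h₀ : u 0 = v 0) : u = v := by
  have hlip : LipschitzWith (‖k‖₊ * (1 * ‖(2⁻¹ : ℝ)‖₊)) fun y : ℝ ↦ k * cos (2⁻¹ * y) :=
    (lipschitzWith_smul k).comp (lipschitzWith_cos.comp (lipschitzWith_smul (2⁻¹ : ℝ)))
  refine ODE_solution_unique_univ (v := fun _ y ↦ k * cos (2⁻¹ * y)) (s := fun _ ↦ Set.univ)
    (t₀ := 0) (fun _ ↦ hlip.lipschitzOnWith) (fun t ↦ ⟨?_, trivial⟩) (fun t ↦ ⟨?_, trivial⟩) h₀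
  · simpa [div_eq_inv_mul] using hu t
  · simpa [div_eq_inv_mul] using hv t

/-- Solutions of `κ u' = 2 cos (u / 2)` starting in `[-π, π]`. -/
theorem eq_two_mul_arcsin_tanh_of_hasDerivAt {κ : ℝ} {u : ℝ → ℝ}
    (hu : ∀ x, HasDerivAt u (2 / κ * cos (u x / 2)) x) (h₀ : |u 0| ≤ π) :
    (∀ x, u x = π) ∨ (∀ x, u x = -π) ∨
      ∃ c, ∀ x, u x = 2 * arcsin (tanh (x / κ + c)) := by
  have hconst {b : ℝ} (hb : cos (b / 2) = 0) (hub : u 0 = b) (x : ℝ) : u x = b :=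
    congrFun (eq_of_hasDerivAt_mul_cos_half hu (v := fun _ ↦ b)
      (fun x ↦ by simpa [hb] using hasDerivAt_const x b) hub) x
  obtain ⟨hl, hr⟩ := abs_le.1 h₀
  rcases hr.eq_or_lt with hr | hr
  · exact .inl (hconst cos_pi_div_two hr)
  rcases hl.eq_or_lt with hl | hl
  · exact .inr (.inl (hconst (by rw [neg_div, cos_neg, cos_pi_div_two]) hl.symm))
  have hpos : 0 < cos (u 0 / 2) := cos_pos_of_mem_Ioo ⟨by linarith, by linarith⟩
  have hmem : sin (u 0 / 2) ∈ Set.Ioo (-1) 1 := by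
    constructor <;> nlinarith [sin_sq_add_cos_sq (u 0 / 2)]
  refine .inr (.inr ⟨artanh (sin (u 0 / 2)), fun x ↦ congrFun
    (eq_of_hasDerivAt_mul_cos_half hu
      (v := fun y ↦ 2 * arcsin (tanh (y / κ + artanh (sin (u 0 / 2))))) (fun y ↦ ?_) ?_) x⟩)
  · have h := ((hasDerivAt_arcsin_tanh (y / κ + artanh (sin (u 0 / 2)))).comp y
      (((hasDerivAt_id y).div_const κ).add_const _)).const_mul 2
    refine h.congr_deriv ?_
    rw [mul_div_cancel_left₀ _ (two_ne_zero' ℝ)]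
    ring
  · rw [zero_div, zero_add, tanh_artanh hmem, arcsin_sin (by linarith) (by linarith)]
    ring

/-- If `κ u' - 2 cos (u / 2)` vanishes at one point, it vanishes everywhere. -/
theorem hasDerivAt_mul_cos_half_of_eq {κ : ℝ} (hκ : 0 < κ) {u u' : ℝ → ℝ}
    (hu : ∀ x, HasDerivAt u (u' x) x) (hu' : ∀ x, HasDerivAt u' (-(sin (u x) / κ ^ 2)) x)
    (h₀ : κ * u' 0 = 2 * cos (u 0 / 2)) (x : ℝ) :
    HasDerivAt u (2 / κ * cos (u x / 2)) x := by
  have hzero : (fun x ↦ κ * u' x - 2 * cos (u x / 2)) = fun _ ↦ 0 := by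
    refine eq_zero_of_hasDerivAt_mul (a := fun x ↦ sin (u x / 2) / κ) (K := ‖κ‖₊⁻¹) (t₀ := 0)
      (fun t ↦ ?_) (fun t ↦ ?_) (sub_eq_zero.2 h₀)
    · rw [nnnorm_div, div_eq_mul_inv]
      exact mul_le_of_le_one_left' (abs_sin_le_one _)
    · refine (((hu' t).const_mul κ).fun_sub
        (((hu t).div_const 2).cos.const_mul 2)).congr_deriv ?_
      rw [show sin (u t) = 2 * sin (u t / 2) * cos (u t / 2) by rw [← sin_two_mul]; ring_nf]
      field_simp
      ring
  have hx : κ * u' x - 2 * cos (u x / 2) = 0 := congrFun hzero x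
  refine (hu x).congr_deriv ?_
  field_simp
  linarith


/-- **Classification of bounded steady states with first-integral constant `C = 1`.**
If `u` is a bounded solution of `κ²u'' + sin u = 0` on `ℝ` with `|u(0)| ≤ π` and
`(κ²/2)(u')² = 1 + cos u`, then `u ≡ π`, `u ≡ -π`, or `u(x) = ±2 arcsin(tanh(x/κ + c))`
for some constant `c`. -/
theorem sine_gordon_steady_state_C_eq_one
    (κ : ℝ) (hκ : 0 < κ) (u : ℝ → ℝ)
    (hbdd : ∃ M : ℝ, ∀ x : ℝ, |u x| ≤ M)
    (hu : ∀ x : ℝ, DifferentiableAt ℝ u x)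
    (hu' : ∀ x : ℝ, DifferentiableAt ℝ (deriv u) x)
    (heq : ∀ x : ℝ, κ ^ 2 * deriv (deriv u) x + Real.sin (u x) = 0)
    (h0 : |u 0| ≤ π)
    (hfi : ∀ x : ℝ, κ ^ 2 / 2 * (deriv u x) ^ 2 = 1 + Real.cos (u x)) :
    (∀ x : ℝ, u x = π) ∨ (∀ x : ℝ, u x = -π) ∨
    (∃ c : ℝ, ∀ x : ℝ, u x = 2 * Real.arcsin (Real.tanh (x / κ + c))) ∨
    (∃ c : ℝ, ∀ x : ℝ, u x = -(2 * Real.arcsin (Real.tanh (x / κ + c)))) := by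
  have hd (x : ℝ) : HasDerivAt u (deriv u x) x := (hu x).hasDerivAt
  have hd' (x : ℝ) : HasDerivAt (deriv u) (-(sin (u x) / κ ^ 2)) x := by
    refine (hu' x).hasDerivAt.congr_deriv ?_
    field_simp
    linarith [heq x]
  have hsq : (κ * deriv u 0) ^ 2 = (2 * cos (u 0 / 2)) ^ 2 := by
    have hcos : cos (u 0) = 2 * cos (u 0 / 2) ^ 2 - 1 := by rw [← cos_two_mul]; ring_nf
    linear_combination 2 * hfi 0 + 2 * hcos
  rcases sq_eq_sq_iff_eq_or_eq_neg.1 hsq with h | h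
  · rcases eq_two_mul_arcsin_tanh_of_hasDerivAt (hasDerivAt_mul_cos_half_of_eq hκ hd hd' h) h0
      with h | h | h
    · exact .inl h
    · exact .inr (.inl h)
    · exact .inr (.inr (.inl h))
  · have hn := hasDerivAt_mul_cos_half_of_eq hκ (u := fun x ↦ -u x) (u' := fun x ↦ -deriv u x)
      (fun x ↦ (hd x).fun_neg)
      (fun x ↦ (hd' x).fun_neg.congr_deriv (by rw [sin_neg, neg_div]))
      (by rw [neg_div, cos_neg]; linarith)
    rcases eq_two_mul_arcsin_tanh_of_hasDerivAt hn (by rwa [abs_neg]) with h | h | ⟨c, h⟩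
    · exact .inr (.inl fun x ↦ neg_eq_iff_eq_neg.1 (h x))
    · exact .inl fun x ↦ neg_injective (h x)
    · exact .inr (.inr (.inr ⟨c, fun x ↦ neg_eq_iff_eq_neg.1 (h x)⟩))
end

section
/- Let κ > 0 and -1 < C < 1. Suppose u : ℝ → ℝ is a bounded, twice differentiable, nonconstant function satisfying κ²u''(x) + sin u(x) = 0 for all x ∈ ℝ, |u(0)| ≤ π, and the first integral identity (κ²/2)(u'(x))² = C + cos u(x) for all x ∈ ℝ. Then u is a periodic function (there exists T > 0 with u(x + T) = u(x) for all x), and sup_{x∈ℝ} |u(x)| ≤ arccos(-C) < π. -/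
open Real Filter Topology

/-- If a function is bounded above, a limit of its derivative at infinity is nonpositive. -/
lemma tendsto_deriv_nonpos_of_le {f : ℝ → ℝ} {l M : ℝ} (hf : Differentiable ℝ f)
    (hM : ∀ x, f x ≤ M) (hl : Tendsto (deriv f) atTop (𝓝 l)) : l ≤ 0 := by
  by_contra! hpos
  obtain ⟨N, hN⟩ := eventually_atTop.1 (hl.eventually_const_lt (half_lt_self hpos))
  set y := N + (M - f N + 1) / (l / 2) with hy
  have hfN : 0 < (M - f N + 1) / (l / 2) := by
    have := hM N
    apply div_pos <;> linarith
  have key := (convex_Ici N).mul_sub_le_image_sub_of_le_deriv hf.continuous.continuousOn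
    hf.differentiableOn (C := l / 2)
    (fun x hx => (hN x (interior_subset hx)).le) N Set.self_mem_Ici y
    (Set.mem_Ici.2 (by linarith)) (by linarith)
  have : l / 2 * (y - N) = M - f N + 1 := by
    rw [hy]
    field_simp
    ring
  linarith [hM y]

/-- A bounded function whose derivative converges at infinity has derivative tending to zero. -/
lemma tendsto_deriv_eq_zero_of_bounded {f : ℝ → ℝ} {l M : ℝ} (hf : Differentiable ℝ f)
    (hM : ∀ x, |f x| ≤ M) (hl : Tendsto (deriv f) atTop (𝓝 l)) : l = 0 := by
  refine le_antisymm
    (tendsto_deriv_nonpos_of_le hf (fun x => (le_abs_self _).trans (hM x)) hl) ?_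
  have := tendsto_deriv_nonpos_of_le hf.neg (M := M) (l := -l)
    (fun x => (neg_le_abs _).trans (hM x)) (by rw [deriv.neg']; exact hl.neg)
  linarith

/-- A bounded steady state with `-1 < C < 1` cannot be increasing on a half-line. -/
lemma sine_gordon_not_deriv_pos {κ C M x₀ : ℝ} (hκ : 0 < κ) (hC₁ : -1 < C) (hC₂ : C < 1)
    {u : ℝ → ℝ} (hM : ∀ x, |u x| ≤ M) (hu : Differentiable ℝ u)
    (hu' : Differentiable ℝ (deriv u))
    (heq : ∀ x, κ ^ 2 * deriv (deriv u) x + Real.sin (u x) = 0)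
    (hfi : ∀ x, κ ^ 2 / 2 * (deriv u x) ^ 2 = C + Real.cos (u x))
    (hpos : ∀ x, x₀ < x → 0 < deriv u x) : False := by
  have hmono : StrictMonoOn u (Set.Ici x₀) :=
    strictMonoOn_of_deriv_pos (convex_Ici _) hu.continuous.continuousOn
      (fun x hx => hpos x (by simpa using hx))
  have hw : Monotone fun x => u (max x x₀) := fun x y hxy =>
    hmono.monotoneOn (Set.mem_Ici.2 (le_max_right _ _)) (Set.mem_Ici.2 (le_max_right _ _))
      (max_le_max_right _ hxy)
  obtain ⟨L, hL⟩ : ∃ L, Tendsto u atTop (𝓝 L) := by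
    refine ⟨_, (tendsto_atTop_ciSup hw ⟨M, ?_⟩).congr' ?_⟩
    · rintro _ ⟨x, rfl⟩
      exact (le_abs_self _).trans (hM _)
    · filter_upwards [eventually_ge_atTop x₀] with x hx
      simp [hx]
  have hsq : ∀ x, (deriv u x) ^ 2 = 2 / κ ^ 2 * (C + Real.cos (u x)) := fun x => by
    rw [← hfi x]
    field_simp
  have hcos : Tendsto (fun x => 2 / κ ^ 2 * (C + Real.cos (u x))) atTop
      (𝓝 (2 / κ ^ 2 * (C + Real.cos L))) :=
    (((Real.continuous_cos.tendsto L).comp hL).const_add C).const_mul _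
  have hd : Tendsto (deriv u) atTop (𝓝 √(2 / κ ^ 2 * (C + Real.cos L))) := by
    refine hcos.sqrt.congr' ?_
    filter_upwards [eventually_gt_atTop x₀] with x hx
    rw [← hsq, Real.sqrt_sq (hpos x hx).le]
  have hd0 : Tendsto (deriv u) atTop (𝓝 0) :=
    tendsto_deriv_eq_zero_of_bounded hu hM hd ▸ hd
  have hcosL : C + Real.cos L = 0 := by
    have h := tendsto_nhds_unique (hcos.congr fun x => (hsq x).symm) (hd0.pow 2)
    have : 2 / κ ^ 2 ≠ 0 := by positivity
    simpa [this, hκ.ne'] using h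
  have hdd : Tendsto (deriv (deriv u)) atTop (𝓝 (-Real.sin L / κ ^ 2)) := by
    refine ((((Real.continuous_sin.tendsto L).comp hL).neg).div_const (κ ^ 2)).congr fun x => ?_
    have := heq x
    simp only [Function.comp_apply]
    field_simp
    linarith
  have hbd : ∀ x, |deriv u x| ≤ √(4 / κ ^ 2) := fun x => by
    refine Real.abs_le_sqrt ?_
    rw [hsq, div_mul_eq_mul_div]
    gcongr
    linarith [Real.cos_le_one (u x)]
  have hsin := tendsto_deriv_eq_zero_of_bounded hu' hbd hdd
  have hsinL : Real.sin L = 0 := by simpa [hκ.ne'] using hsin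
  nlinarith [Real.sin_sq_add_cos_sq L]

/-- The derivative of a bounded steady state with `-1 < C < 1` has arbitrarily large zeros. -/
lemma sine_gordon_exists_deriv_eq_zero {κ C M : ℝ} (hκ : 0 < κ) (hC₁ : -1 < C) (hC₂ : C < 1)
    {u : ℝ → ℝ} (hM : ∀ x, |u x| ≤ M) (hu : Differentiable ℝ u)
    (hu' : Differentiable ℝ (deriv u))
    (heq : ∀ x, κ ^ 2 * deriv (deriv u) x + Real.sin (u x) = 0)
    (hfi : ∀ x, κ ^ 2 / 2 * (deriv u x) ^ 2 = C + Real.cos (u x)) (x₀ : ℝ) :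
    ∃ x, x₀ < x ∧ deriv u x = 0 := by
  by_contra! hne
  obtain ⟨p, hp, hp'⟩ : ∃ p, x₀ < p ∧ deriv u p ≤ 0 := by
    by_contra! h
    exact sine_gordon_not_deriv_pos hκ hC₁ hC₂ hM hu hu' heq hfi h
  have hdn : deriv (fun x => -u x) = fun x => -deriv u x := deriv.fun_neg'
  obtain ⟨q, hq, hq'⟩ : ∃ q, x₀ < q ∧ 0 ≤ deriv u q := by
    by_contra! h
    refine sine_gordon_not_deriv_pos (u := fun x => -u x) (x₀ := x₀) hκ hC₁ hC₂ (M := M)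
      (fun x => by simpa using hM x) hu.fun_neg ?_ (fun x => ?_) (fun x => ?_) (fun x hx => ?_)
    · rw [hdn]
      exact hu'.fun_neg
    · rw [hdn, deriv.fun_neg, Real.sin_neg]
      linarith [heq x]
    · rw [hdn, Real.cos_neg, neg_sq]
      exact hfi x
    · rw [hdn]
      linarith [h x hx]
  obtain ⟨x, hx, hx0⟩ := isPreconnected_Ioi.intermediate_value (Set.mem_Ioi.2 hp)
    (Set.mem_Ioi.2 hq) hu'.continuous.continuousOn ⟨hp', hq'⟩
  exact hne x hx hx0

/-- A steady state is symmetric about each of its critical points. -/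
lemma sine_gordon_reflect {κ p : ℝ} (hκ : 0 < κ) {u : ℝ → ℝ} (hu : Differentiable ℝ u)
    (hu' : Differentiable ℝ (deriv u))
    (heq : ∀ x, κ ^ 2 * deriv (deriv u) x + Real.sin (u x) = 0)
    (hp : deriv u p = 0) (x : ℝ) : u (2 * p - x) = u x := by
  have hdd : ∀ x, deriv (deriv u) x = -(κ ^ 2)⁻¹ * Real.sin (u x) := fun x => by
    have := heq x
    field_simp
    linarith
  obtain ⟨K, hK⟩ : ∃ K, LipschitzWith K
      fun z : ℝ × ℝ => (z.2, -(κ ^ 2)⁻¹ * Real.sin z.1) :=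
    ⟨_, LipschitzWith.prod_snd.prodMk
      ((lipschitzWith_smul (-(κ ^ 2)⁻¹)).comp
        (Real.lipschitzWith_sin.comp LipschitzWith.prod_fst))⟩
  have hf : ∀ t, HasDerivAt (fun x => (u x, deriv u x))
      (deriv u t, -(κ ^ 2)⁻¹ * Real.sin (u t)) t := fun t =>
    (hu t).hasDerivAt.prodMk (hdd t ▸ (hu' t).hasDerivAt)
  have hg : ∀ t, HasDerivAt (fun x => (u (2 * p - x), -deriv u (2 * p - x)))
      (-deriv u (2 * p - t), -(κ ^ 2)⁻¹ * Real.sin (u (2 * p - t))) t := fun t => by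
    refine ((hu _).hasDerivAt.comp_const_sub (2 * p) t).prodMk ?_
    have := ((hu' _).hasDerivAt.comp_const_sub (2 * p) t).fun_neg
    rwa [neg_neg, hdd] at this
  have h := ODE_solution_unique_univ (t₀ := p) (s := fun _ => Set.univ)
    (v := fun _ z => (z.2, -(κ ^ 2)⁻¹ * Real.sin z.1))
    (fun _ => hK.lipschitzOnWith) (fun t => ⟨hg t, trivial⟩) (fun t => ⟨hf t, trivial⟩)
    (by simp [two_mul, hp])
  exact congrArg Prod.fst (congrFun h x)

/-- A continuous function with `cos u ≥ cos a` that starts in `[-π, π]` stays in `[-a, a]`. -/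
lemma abs_le_of_cos_le_cos_comp {a : ℝ} (ha : 0 ≤ a) (haπ : a < π) {u : ℝ → ℝ}
    (hu : Continuous u) (h0 : |u 0| ≤ π) (hcos : ∀ x, Real.cos a ≤ Real.cos (u x)) (x : ℝ) :
    |u x| ≤ a := by
  have key : ∀ y, |u y| ≤ π → |u y| ≤ a := fun y hy => by
    by_contra! h
    have := Real.cos_lt_cos_of_nonneg_of_le_pi ha hy h
    rw [Real.cos_abs] at this
    exact this.not_ge (hcos y)
  refine key x ?_
  by_contra! hx
  obtain ⟨y, -, hy⟩ := isPreconnected_univ.intermediate_value (Set.mem_univ 0)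
    (Set.mem_univ x) hu.abs.continuousOn ⟨h0, hx.le⟩
  exact (key y hy.le).not_gt (haπ.trans_eq hy.symm)

/-- **Bounded nonconstant steady states with `-1 < C < 1` are periodic.**
If `u` is a bounded, nonconstant solution of `κ²u'' + sin u = 0` on `ℝ` with
`|u(0)| ≤ π` and first integral `(κ²/2)(u')² = C + cos u` for some `-1 < C < 1`,
then `u` is periodic and `sup |u| ≤ arccos(-C) < π`. -/
theorem sine_gordon_steady_state_periodic
    (κ C : ℝ) (hκ : 0 < κ) (hC₁ : -1 < C) (hC₂ : C < 1) (u : ℝ → ℝ)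
    (hbdd : ∃ M : ℝ, ∀ x : ℝ, |u x| ≤ M)
    (hnonconst : ∃ a b : ℝ, u a ≠ u b)
    (hu : ∀ x : ℝ, DifferentiableAt ℝ u x)
    (hu' : ∀ x : ℝ, DifferentiableAt ℝ (deriv u) x)
    (heq : ∀ x : ℝ, κ ^ 2 * deriv (deriv u) x + Real.sin (u x) = 0)
    (h0 : |u 0| ≤ π)
    (hfi : ∀ x : ℝ, κ ^ 2 / 2 * (deriv u x) ^ 2 = C + Real.cos (u x)) :
    (∃ T : ℝ, 0 < T ∧ ∀ x : ℝ, u (x + T) = u x) ∧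
    (∀ x : ℝ, |u x| ≤ Real.arccos (-C)) ∧
    Real.arccos (-C) < π := by
  obtain ⟨M, hM⟩ := hbdd
  have hlt : Real.arccos (-C) < π := by
    rw [← Real.arccos_neg_one]
    exact Real.arccos_lt_arccos le_rfl (by linarith) (by linarith)
  refine ⟨?_, abs_le_of_cos_le_cos_comp (Real.arccos_nonneg _) hlt
    (Differentiable.continuous hu) h0 fun x => ?_, hlt⟩
  · obtain ⟨p, -, hp⟩ := sine_gordon_exists_deriv_eq_zero hκ hC₁ hC₂ hM hu hu' heq hfi 0
    obtain ⟨q, hpq, hq⟩ := sine_gordon_exists_deriv_eq_zero hκ hC₁ hC₂ hM hu hu' heq hfi p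
    refine ⟨2 * (q - p), by linarith, fun x => ?_⟩
    rw [← sine_gordon_reflect hκ hu hu' heq hp x, ← sine_gordon_reflect hκ hu hu' heq hq]
    congr 1
    ring
  · rw [Real.cos_arccos (by linarith) (by linarith)]
    have : 0 ≤ κ ^ 2 / 2 * (deriv u x) ^ 2 := by positivity
    linarith [hfi x]
end

section
/- (Energy dissipation of the first-order IMEX scheme.) Let d ≥ 1, κ > 0, and 0 < τ ≤ 2. Let (u^n)_{n≥0} be a sequence of smooth functions ℝ^d → ℝ, each 2π-periodic in every coordinate, satisfying for every n ≥ 0 and every x the scheme equation (u^{n+1}(x) - u^n(x))/τ = κ²Δu^{n+1}(x) + sin(u^n(x)). Then the discrete energy E(u^n) = (κ²/2)∫_{[-π,π]^d} |∇u^n|² dx + ∫_{[-π,π]^d} cos(u^n) dx satisfies E(u^{n+1}) ≤ E(u^n) for all n ≥ 0. -/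
open MeasureTheory Real

/-- The squared norm of the spatial gradient of `f : ℝ^d → ℝ` at `x`. -/
noncomputable def gradNormSq {d : ℕ} (f : (Fin d → ℝ) → ℝ) (x : Fin d → ℝ) : ℝ :=
  ∑ i, (fderiv ℝ f x (Pi.single i 1)) ^ 2

/-- The fundamental cell `[-π, π]^d` of the torus. -/
def torusBox (d : ℕ) : Set (Fin d → ℝ) :=
  Set.univ.pi fun _ => Set.Icc (-π) π

/-- The sine-Gordon energy `E(v) = ∫_{[-π,π]^d} (κ²/2 |∇v|² + cos v) dx`. -/
noncomputable def energy {d : ℕ} (κ : ℝ) (v : (Fin d → ℝ) → ℝ) : ℝ :=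
  ∫ x in torusBox d, (κ ^ 2 / 2 * gradNormSq v x + Real.cos (v x))

/-- The quadratic upper bound for the cosine, whose second derivative is at most `1`. -/
theorem cos_le_tangent_add_sq (a b : ℝ) :
    Real.cos b ≤ Real.cos a - Real.sin a * (b - a) + (b - a) ^ 2 / 2 := by
  have hd : ∀ x : ℝ, HasDerivAt (fun x : ℝ => x ^ 2 / 2 - Real.cos x) (x + Real.sin x) x := by
    intro x
    have h := ((hasDerivAt_pow 2 x).div_const 2).sub (Real.hasDerivAt_cos x)
    exact h.congr_deriv (by norm_num)
  have hderiv : deriv (fun x : ℝ => x ^ 2 / 2 - Real.cos x) = fun x => x + Real.sin x :=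
    funext fun x => (hd x).deriv
  have hmono : Monotone fun x : ℝ => x + Real.sin x := by
    refine monotone_of_hasDerivAt_nonneg
      (fun x => (hasDerivAt_id x).add (Real.hasDerivAt_sin x)) fun x => ?_
    have := Real.neg_one_le_cos x
    simp only [Pi.zero_apply]
    linarith
  have hconv : ConvexOn ℝ Set.univ (fun x : ℝ => x ^ 2 / 2 - Real.cos x) :=
    Monotone.convexOn_univ_of_deriv (fun x => (hd x).differentiableAt) (hderiv ▸ hmono)
  rcases lt_trichotomy a b with h | rfl | h
  · have := hconv.le_slope_of_hasDerivAt (Set.mem_univ a) (Set.mem_univ b) h (hd a)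
    rw [slope_def_field, le_div_iff₀ (sub_pos.2 h)] at this
    nlinarith
  · simp
  · have := hconv.slope_le_of_hasDerivAt (Set.mem_univ b) (Set.mem_univ a) h (hd a)
    rw [slope_def_field, div_le_iff₀ (sub_pos.2 h)] at this
    nlinarith

theorem torusBox_eq_Icc (d : ℕ) : torusBox d = Set.Icc (fun _ => -π) (fun _ => π) :=
  Set.pi_univ_Icc _ _

theorem Continuous.integrableOn_torusBox {d : ℕ} {g : (Fin d → ℝ) → ℝ} (hg : Continuous g) :
    IntegrableOn g (torusBox d) := by
  rw [torusBox_eq_Icc]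
  exact hg.continuousOn.integrableOn_compact isCompact_Icc

/-- The divergence of a periodic `C¹` vector field integrates to zero over the torus. -/
theorem integral_torusBox_divergence_eq_zero {d : ℕ} (f : Fin d → (Fin d → ℝ) → ℝ)
    (hf : ∀ i, ContDiff ℝ 1 (f i))
    (hper : ∀ i x, f i (x + Pi.single i (2 * π)) = f i x) :
    ∫ x in torusBox d, ∑ i, fderiv ℝ (f i) x (Pi.single i 1) = 0 := by
  cases d with
  | zero => simp
  | succ n =>
    have hcont : Continuous fun x => ∑ i, fderiv ℝ (f i) x (Pi.single i 1) :=
      continuous_finsetSum _ fun i _ =>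
        ((hf i).continuous_fderiv one_ne_zero).clm_apply continuous_const
    have hint := hcont.integrableOn_torusBox
    rw [torusBox_eq_Icc] at hint ⊢
    rw [integral_divergence_of_hasFDerivAt_off_countable' (fun _ => -π) (fun _ => π)
      (fun _ => by linarith [Real.pi_pos]) f (fun i => fderiv ℝ (f i)) ∅ Set.countable_empty
      (fun i => (hf i).continuous.continuousOn)
      (fun x _ i => ((hf i).differentiable one_ne_zero x).hasFDerivAt) hint]
    refine Finset.sum_eq_zero fun i _ => sub_eq_zero.2 ?_
    congr 1
    funext y
    rw [← hper i (i.insertNth (-π) y)]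
    congr 1
    ext j
    refine Fin.succAboveCases i ?_ (fun k => ?_) j
    · simp
      ring
    · simp

theorem fderiv_add_period {d : ℕ} {v : (Fin d → ℝ) → ℝ} {c : Fin d → ℝ}
    (hv : ∀ x, v (x + c) = v x) (x : Fin d → ℝ) : fderiv ℝ v (x + c) = fderiv ℝ v x := by
  rw [← fderiv_comp_add_right]
  simp only [hv]

theorem continuous_energy_density {d : ℕ} (κ : ℝ) {v : (Fin d → ℝ) → ℝ}
    (hv : ContDiff ℝ 1 v) :
    Continuous fun x => κ ^ 2 / 2 * gradNormSq v x + Real.cos (v x) := by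
  have h : Continuous (gradNormSq v) := continuous_finsetSum _ fun i _ =>
    ((hv.continuous_fderiv one_ne_zero).clm_apply continuous_const).pow 2
  exact (continuous_const.mul h).add (Real.continuous_cos.comp hv.continuous)

/-- One step of the scheme changes the energy density by at most a divergence. -/
theorem energy_density_le {d : ℕ} {κ τ : ℝ} (hτ0 : 0 < τ) (hτ2 : τ ≤ 2)
    {u v : (Fin d → ℝ) → ℝ} (hu : ContDiff ℝ 1 u) (hv : ContDiff ℝ 2 v) (x : Fin d → ℝ)
    (h : (v x - u x) / τ = κ ^ 2 * lap v x + Real.sin (u x)) :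
    κ ^ 2 / 2 * gradNormSq v x + Real.cos (v x) ≤
      (κ ^ 2 / 2 * gradNormSq u x + Real.cos (u x)) +
        κ ^ 2 * ∑ i, fderiv ℝ (fun y => (v y - u y) * fderiv ℝ v y (Pi.single i 1)) x
          (Pi.single i 1) := by
  have hdu := hu.differentiable one_ne_zero x
  have hdv := hv.differentiable two_ne_zero x
  have hdiv : ∀ i, fderiv ℝ (fun y => (v y - u y) * fderiv ℝ v y (Pi.single i 1)) x
      (Pi.single i 1) =
      (v x - u x) * fderiv ℝ (fun y => fderiv ℝ v y (Pi.single i 1)) x (Pi.single i 1) +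
        fderiv ℝ v x (Pi.single i 1) *
          (fderiv ℝ v x (Pi.single i 1) - fderiv ℝ u x (Pi.single i 1)) := by
    intro i
    have hd : DifferentiableAt ℝ (fun y => fderiv ℝ v y (Pi.single i 1)) x :=
      ((hv.fderiv_right (m := 1) (by norm_num)).clm_apply contDiff_const).differentiable
        one_ne_zero x
    rw [fderiv_fun_mul (hdv.fun_sub hdu) hd, fderiv_fun_sub hdv hdu]
    simp
  have hgrad : gradNormSq v x ≤ gradNormSq u x + 2 * ∑ i, fderiv ℝ v x (Pi.single i 1) *
      (fderiv ℝ v x (Pi.single i 1) - fderiv ℝ u x (Pi.single i 1)) := by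
    unfold gradNormSq
    rw [Finset.mul_sum, ← Finset.sum_add_distrib]
    refine Finset.sum_le_sum fun i _ => ?_
    nlinarith [sq_nonneg (fderiv ℝ v x (Pi.single i 1) - fderiv ℝ u x (Pi.single i 1))]
  have hcos := cos_le_tangent_add_sq (u x) (v x)
  have hlap : κ ^ 2 * lap v x = (v x - u x) / τ - Real.sin (u x) := by linarith
  have hsq : (v x - u x) ^ 2 / 2 ≤ (v x - u x) ^ 2 / τ :=
    div_le_div_of_nonneg_left (sq_nonneg _) hτ0 hτ2
  have hmul : κ ^ 2 * ((v x - u x) * lap v x) =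
      (v x - u x) ^ 2 / τ - Real.sin (u x) * (v x - u x) := by
    linear_combination (v x - u x) * hlap
  have hκ := mul_le_mul_of_nonneg_left hgrad (by positivity : 0 ≤ κ ^ 2 / 2)
  simp only [hdiv, Finset.sum_add_distrib, ← Finset.mul_sum]
  change _ ≤ _ + κ ^ 2 * ((v x - u x) * lap v x + _)
  linarith

/-- **Energy dissipation of the first-order IMEX scheme.**
For the scheme `(u^{n+1} - u^n)/τ = κ²Δu^{n+1} + sin(u^n)` with `0 < τ ≤ 2`,
the energy `E(uⁿ)` is nonincreasing in `n`. -/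
theorem imex_energy_dissipation
    (d : ℕ) (hd : 1 ≤ d) (κ τ : ℝ) (hκ : 0 < κ) (hτ0 : 0 < τ) (hτ2 : τ ≤ 2)
    (u : ℕ → (Fin d → ℝ) → ℝ)
    (hsmooth : ∀ n : ℕ, ContDiff ℝ (⊤ : ℕ∞) (u n))
    (hper : ∀ n : ℕ, ∀ x : Fin d → ℝ, ∀ i : Fin d,
      u n (x + Pi.single i (2 * π)) = u n x)
    (hscheme : ∀ n : ℕ, ∀ x : Fin d → ℝ,
      (u (n + 1) x - u n x) / τ = κ ^ 2 * lap (u (n + 1)) x + Real.sin (u n x)) :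
    ∀ n : ℕ, energy κ (u (n + 1)) ≤ energy κ (u n) := by
  intro n
  have hv := hsmooth (n + 1)
  have hu : ContDiff ℝ 1 (u n) := by exact_mod_cast contDiff_infty.1 (hsmooth n) 1
  have hv2 : ContDiff ℝ 2 (u (n + 1)) := contDiff_infty.1 hv 2
  have hv1 : ContDiff ℝ 1 (u (n + 1)) := hv2.of_le one_le_two
  have hF : ∀ i : Fin d, ContDiff ℝ 1
      fun y => (u (n + 1) y - u n y) * fderiv ℝ (u (n + 1)) y (Pi.single i 1) := fun i =>
    (hv1.sub hu).mul ((hv2.fderiv_right (by norm_num)).clm_apply contDiff_const)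
  have hzero := integral_torusBox_divergence_eq_zero _ hF fun i x => by
    simp only [hper, fderiv_add_period fun x => hper (n + 1) x i]
  have hcont : Continuous fun x => ∑ i, fderiv ℝ
      (fun y => (u (n + 1) y - u n y) * fderiv ℝ (u (n + 1)) y (Pi.single i 1)) x
        (Pi.single i 1) :=
    continuous_finsetSum _ fun i _ =>
      ((hF i).continuous_fderiv one_ne_zero).clm_apply continuous_const
  have hIu := (continuous_energy_density κ hu).integrableOn_torusBox
  have hIv := (continuous_energy_density κ hv1).integrableOn_torusBox
  have hID := hcont.integrableOn_torusBox.const_mul (κ ^ 2)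
  calc energy κ (u (n + 1)) ≤ _ := integral_mono hIv (hIu.add hID) fun x =>
        energy_density_le hτ0 hτ2 hu hv2 x (hscheme n x)
    _ = energy κ (u n) := by
        simp only [Pi.add_apply]
        rw [integral_add hIu hID, integral_const_mul, hzero, mul_zero, add_zero]
        rfl
end
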